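/- For any 0-formula φ (a formula containing no intensional set): φ is an SQHT=_S tautology if and only if φ is an SQHT=_F tautology. -/

import Mathlib

open Classical

noncomputable section

/-! ## Worlds (here and there) -/

inductive W : Type
  | h
  | t

/-- The ordering `h ≤ t` on worlds. -/
def W.le : W → W → Prop
  | .h, _ => True
  | .t, .t => True
  | .t, .h => False

/-! ## Tuples: nonempty finite tuples, encoded as head + tail -/

abbrev Tup (α : Type u) : Type u := α × List α

/-- The tuple `(g 0, …, g n)` determined by a family on `Fin (n+1)`. -/
def famToTup {α : Type u} {n : ℕ} (g : Fin (n + 1) → α) : Tup α :=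
  (g 0, List.ofFn fun i : Fin n => g i.succ)

/-- Combine a finite family of optional values into an optional family:
`some` iff all components are defined. -/
def optFam {α : Type u} {m : ℕ} (f : Fin m → Option α) : Option (Fin m → α) :=
  if h : ∀ i, (f i).isSome then some fun i => (f i).get (h i) else none

/-! ## The domain `D`: atoms (Herbrand terms) plus, at each finite level,
all sets of (nonempty) tuples over the previous level.
We realise it as the quotient of a type of "pre-domain elements" of finite
rank by extensional equivalence. -/

/-- Pre-domain elements over a type `A` of atoms: an atom, or a set of
nonempty tuples (each tuple encoded as head + tail), indexed by an arbitrary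
(small) index type. -/
inductive PD (A : Type) : Type 1
  | atom : A → PD A
  | set : (ι : Type) → (ι → PD A) → (ι → List (PD A)) → PD A

/-- `x` has rank at most `n` (atoms have rank `0`). -/
def PD.rankLe {A : Type} : ℕ → PD A → Prop
  | 0, .atom _ => True
  | 0, .set _ _ _ => False
  | _ + 1, .atom _ => True
  | n + 1, .set _ hd tl => ∀ i, PD.rankLe n (hd i) ∧ ∀ z ∈ tl i, PD.rankLe n z

/-- Finite rank: the element appears at some finite level `D^i` of the
domain hierarchy. -/
def PD.FiniteRank {A : Type} (x : PD A) : Prop := ∃ n, PD.rankLe n x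

/-- Extensional equivalence up to depth `n`. -/
def PD.EquivLe {A : Type} : ℕ → PD A → PD A → Prop
  | 0, .atom a, .atom b => a = b
  | 0, _, _ => False
  | _ + 1, .atom a, .atom b => a = b
  | n + 1, .set _ hd tl, .set _ hd' tl' =>
      (∀ i, ∃ j, PD.EquivLe n (hd i) (hd' j) ∧ List.Forall₂ (PD.EquivLe n) (tl i) (tl' j)) ∧
      (∀ j, ∃ i, PD.EquivLe n (hd i) (hd' j) ∧ List.Forall₂ (PD.EquivLe n) (tl i) (tl' j))
  | _ + 1, _, _ => False

/-- Extensional equivalence (witnessed at some finite depth). -/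
def PD.Equiv {A : Type} (x y : PD A) : Prop := ∃ n, PD.EquivLe n x y

/-- The domain over atoms `A`: finite-rank pre-domain elements modulo
extensional equivalence. -/
def DD (A : Type) : Type 1 :=
  Quot fun x y : { z : PD A // z.FiniteRank } => PD.Equiv x.1 y.1

def toD {A : Type} (x : PD A) (h : x.FiniteRank) : DD A := Quot.mk _ ⟨x, h⟩

def atomD {A : Type} (a : A) : DD A := toD (PD.atom a) ⟨0, by simp [PD.rankLe]⟩

/-- `z` (a pre-domain element) represents the domain element `w`. -/
def repD {A : Type} (z : PD A) (w : DD A) : Prop := ∃ h, w = toD z h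

/-- Membership of a tuple in a domain element (meaningful when the latter
is a set). -/
def dmem {A : Type} (v : Tup (DD A)) (d : DD A) : Prop :=
  ∃ (ι : Type) (hd : ι → PD A) (tl : ι → List (PD A)) (hfr : (PD.set ι hd tl).FiniteRank),
    d = toD (PD.set ι hd tl) hfr ∧ ∃ i, repD (hd i) v.1 ∧ List.Forall₂ repD (tl i) v.2

/-- The domain elements that are sets (the subset `𝒮 = D ∖ D⁰`). -/
def IsSetD {A : Type} (d : DD A) : Prop :=
  ∃ (ι : Type) (hd : ι → PD A) (tl : ι → List (PD A)) (hfr : (PD.set ι hd tl).FiniteRank),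
    d = toD (PD.set ι hd tl) hfr

/-- The domain element whose members are exactly the tuples in `s`
(`none` if there is no such element of the domain). -/
def mkSet? {A : Type} (s : Set (Tup (DD A))) : Option (DD A) :=
  if h : ∃ d : DD A, IsSetD d ∧ ∀ v, dmem v d ↔ v ∈ s then some h.choose else none


universe v

/-! ## Signatures -/

/-- A signature: Herbrand function (constructor) names `C`, evaluable
function names `F`, and predicate names `P`, each with an arity, with at
least one Herbrand constant. -/
structure Sig : Type (v + 1) where
  C : Type
  arC : C → ℕ
  F : Type v
  arF : F → ℕ
  P : Type
  arP : P → ℕ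
  hasConst : ∃ c, arC c = 0

/-- Ground Herbrand terms over constructors `C`. -/
inductive HTerm (C : Type) (ar : C → ℕ) : Type
  | mk : (c : C) → (Fin (ar c) → HTerm C ar) → HTerm C ar

/-- The domain `D` of a signature: the Herbrand universe `Terms_F(C)`
together with all (finite-level) sets of nonempty tuples over it. -/
abbrev D (S : Sig.{v}) : Type 1 := DD (HTerm S.C S.arC)

/-! ## Terms and formulas (with extensional and intensional sets).
Quantified variables and the variables bound by an intensional set are
handled by substitution of arbitrary domain elements (which are available
as constant terms via `GTerm.dom`), so terms and formulas below are the
*ground* terms and *sentences* of the language. -/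

mutual
  inductive GTerm (S : Sig.{v}) : Type (max 1 v)
    /-- every element of the domain is a (ground) term -/
    | dom : D S → GTerm S
    /-- Herbrand (constructor) function application -/
    | ctor : (c : S.C) → (Fin (S.arC c) → GTerm S) → GTerm S
    /-- evaluable function application -/
    | func : (f : S.F) → (Fin (S.arF f) → GTerm S) → GTerm S
    /-- extensional set `{τ⃗₁, …, τ⃗_m}` of `m` tuples of terms, each of
    arity `n+1` -/
    | eset : (m n : ℕ) → (Fin m → Fin (n + 1) → GTerm S) → GTerm S
    /-- intensional set `{x⃗ : τ⃗(x⃗) : φ(x⃗)}` with `k` bound variables and a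
    tuple of `n+1` terms -/
    | iset : (k n : ℕ) → ((Fin k → D S) → Fin (n + 1) → GTerm S) →
        ((Fin k → D S) → Formula S) → GTerm S

  inductive Formula (S : Sig.{v}) : Type (max 1 v)
    | falsum : Formula S
    | verum : Formula S
    | atom : (p : S.P) → (Fin (S.arP p) → GTerm S) → Formula S
    | eq : GTerm S → GTerm S → Formula S
    | and : Formula S → Formula S → Formula S
    | or : Formula S → Formula S → Formula S
    | imp : Formula S → Formula S → Formula S
    | all : (D S → Formula S) → Formula S
    | ex : (D S → Formula S) → Formula S
end

/-- `¬φ` is an abbreviation for `φ → ⊥`. -/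
def Formula.neg {S : Sig.{v}} (φ : Formula S) : Formula S := .imp φ .falsum

/-- Ground atoms over the domain: the Herbrand base. -/
def GAtom (S : Sig.{v}) : Type 1 := Σ p : S.P, Fin (S.arP p) → D S

/-! ## Assignments and interpretations -/

/-- An assignment maps every ground term to a domain element or `none`
(undefined, `u`). -/
abbrev Assign (S : Sig.{v}) := GTerm S → Option (D S)

/-- The conditions an assignment must satisfy: identity on domain
constants, strictness and substitutivity for function application, the
Herbrand interpretation of constructors on atoms, and evaluation of
extensional set terms. -/
def AssignValid {S : Sig.{v}} (σ : Assign S) : Prop :=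
  (∀ d, σ (.dom d) = some d) ∧
  (∀ c args, (∃ i, σ (args i) = none) → σ (.ctor c args) = none) ∧
  (∀ c args (ds : Fin (S.arC c) → D S), (∀ i, σ (args i) = some (ds i)) →
      σ (.ctor c args) = σ (.ctor c fun i => .dom (ds i))) ∧
  (∀ c (hs : Fin (S.arC c) → HTerm S.C S.arC),
      σ (.ctor c fun i => .dom (atomD (hs i))) = some (atomD (HTerm.mk c hs))) ∧
  (∀ f args, (∃ i, σ (args i) = none) → σ (.func f args) = none) ∧
  (∀ f args (ds : Fin (S.arF f) → D S), (∀ i, σ (args i) = some (ds i)) →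
      σ (.func f args) = σ (.func f fun i => .dom (ds i))) ∧
  (∀ m n tups, (∃ j i, σ (tups j i) = none) → σ (.eset m n tups) = none) ∧
  (∀ m n tups (ds : Fin m → Fin (n + 1) → D S), (∀ j i, σ (tups j i) = some (ds j i)) →
      σ (.eset m n tups) = mkSet? { v | ∃ j, v = famToTup (ds j) })

/-- `σ ≼ σ'` : on every ground term, `σ` agrees with `σ'` or is undefined. -/
def AssignLe {S : Sig.{v}} (σ σ' : Assign S) : Prop :=
  ∀ τ, σ τ = σ' τ ∨ σ τ = none

/-- An interpretation `⟨σʰ, σᵗ, Iʰ, Iᵗ⟩`. -/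
structure Interp (S : Sig.{v}) : Type (max 1 v) where
  sh : Assign S
  st : Assign S
  Ih : Set (GAtom S)
  It : Set (GAtom S)

/-- The assignment of `I` at world `w`. -/
def Interp.s {S : Sig.{v}} (I : Interp S) : W → Assign S
  | .h => I.sh
  | .t => I.st

/-- The atoms of `I` at world `w`. -/
def Interp.atoms {S : Sig.{v}} (I : Interp S) : W → Set (GAtom S)
  | .h => I.Ih
  | .t => I.It

/-- The defining conditions of an interpretation: both assignments are
proper assignments, `σʰ ≼ σᵗ` and `Iʰ ⊆ Iᵗ`. -/
def Interp.Valid {S : Sig.{v}} (I : Interp S) : Prop :=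
  AssignValid I.sh ∧ AssignValid I.st ∧ AssignLe I.sh I.st ∧ I.Ih ⊆ I.It

/-! ## 𝒮-satisfaction -/

/-- `SatS I w φ` : `I, w ⊨_𝒮 φ`. -/
def SatS {S : Sig.{v}} (I : Interp S) : W → Formula S → Prop
  | _, .falsum => False
  | _, .verum => True
  | w, .atom p args => ∃ ds : Fin (S.arP p) → D S,
      (∀ i, I.s w (args i) = some (ds i)) ∧ (⟨p, ds⟩ : GAtom S) ∈ I.atoms w
  | w, .eq t1 t2 => ∃ d, I.s w t1 = some d ∧ I.s w t2 = some d
  | w, .and a b => SatS I w a ∧ SatS I w b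
  | w, .or a b => SatS I w a ∨ SatS I w b
  | w, .imp a b => ∀ w', W.le w w' → (SatS I w' a → SatS I w' b)
  | w, .all b => ∀ d, SatS I w (b d)
  | w, .ex b => ∃ d, SatS I w (b d)

/-! ## Extension of intensional sets and the coherent closure -/

/-- The extension `ext(I, w, {x⃗ : τ⃗(x⃗) : φ(x⃗)})`: the set of values of the
tuples `τ⃗(c⃗)` for those `c⃗ ∈ D^k` with `I, w ⊨_𝒮 φ(c⃗)`; it is undefined if
one of these values is undefined (or if the resulting collection is not a
member of the domain). -/
def extw {S : Sig.{v}} (I : Interp S) (w : W) (k n : ℕ)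
    (tv : (Fin k → D S) → Fin (n + 1) → GTerm S)
    (φ : (Fin k → D S) → Formula S) : Option (D S) :=
  if ∃ c : Fin k → D S, SatS I w (φ c) ∧ ∃ i, I.s w (tv c i) = none then none
  else
    mkSet? { val | ∃ (c : Fin k → D S) (ds : Fin (n + 1) → D S),
      SatS I w (φ c) ∧ (∀ i, I.s w (tv c i) = some (ds i)) ∧ val = famToTup ds }

/-- The assignment `σ_I^w` of the coherent closure of `I`: it agrees with
`σ^w` on terms without intensional sets, it assigns to an intensional set
its extension at `t`, at `h` its extension when the two extensions agree
(and `u` otherwise), and is extended to all remaining terms by the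
assignment conditions. -/
def cval {S : Sig.{v}} (I : Interp S) (w : W) : GTerm S → Option (D S)
  | .dom d => some d
  | .ctor c args =>
      match optFam fun i => cval I w (args i) with
      | none => none
      | some ds => I.s w (.ctor c fun i => .dom (ds i))
  | .func f args =>
      match optFam fun i => cval I w (args i) with
      | none => none
      | some ds => I.s w (.func f fun i => .dom (ds i))
  | .eset _ _ tups =>
      match optFam fun j => optFam fun i => cval I w (tups j i) with
      | none => none
      | some g => mkSet? { val | ∃ j, val = famToTup (g j) }
  | .iset k n tv φ =>
      match w with
      | .t => extw I .t k n tv φ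
      | .h => if extw I .h k n tv φ = extw I .t k n tv φ then extw I .h k n tv φ else none

/-- The coherent closure `C(I)` of an interpretation. -/
def CohC {S : Sig.{v}} (I : Interp S) : Interp S :=
  ⟨cval I .h, cval I .t, I.Ih, I.It⟩

/-- `I` is coherent (w.r.t. intensional sets) iff `I = C(I)`. -/
def Interp.Coherent {S : Sig.{v}} (I : Interp S) : Prop := CohC I = I

/-! ## 0-formulas (no intensional sets) and `SQHT⁼_F` over `⟨C ∪ 𝒮, F, P⟩`.
A `0`-formula over `Σ = ⟨C, F, P⟩` is at the same time an `SQHT⁼_F` formula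
over the signature `⟨C ∪ 𝒮, F, P⟩`, whose Herbrand universe is the domain
`D`.  An `SQHT⁼_F` interpretation over `⟨C ∪ 𝒮, F, P⟩` is an interpretation
whose assignments are only defined on terms without intensional sets. -/

mutual
  def IsZeroT {S : Sig.{v}} : GTerm S → Prop
    | .dom _ => True
    | .ctor _ args => ∀ i, IsZeroT (args i)
    | .func _ args => ∀ i, IsZeroT (args i)
    | .eset _ _ tups => ∀ j i, IsZeroT (tups j i)
    | .iset _ _ _ _ => False

  def IsZeroF {S : Sig.{v}} : Formula S → Prop
    | .falsum => True
    | .verum => True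
    | .atom _ args => ∀ i, IsZeroT (args i)
    | .eq t1 t2 => IsZeroT t1 ∧ IsZeroT t2
    | .and a b => IsZeroF a ∧ IsZeroF b
    | .or a b => IsZeroF a ∧ IsZeroF b
    | .imp a b => IsZeroF a ∧ IsZeroF b
    | .all b => ∀ d, IsZeroF (b d)
    | .ex b => ∀ d, IsZeroF (b d)
end

/-- An `SQHT⁼_F` interpretation over `⟨C ∪ 𝒮, F, P⟩`: assignments are given
on the terms without intensional sets only. -/
structure FInterp (S : Sig.{v}) : Type (max 1 v) where
  sh : { τ : GTerm S // IsZeroT τ } → Option (D S)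
  st : { τ : GTerm S // IsZeroT τ } → Option (D S)
  Ih : Set (GAtom S)
  It : Set (GAtom S)

/-- The restriction `Î` of an `SQHT⁼_𝒮` interpretation to the terms without
intensional sets. -/
def Interp.hat {S : Sig.{v}} (I : Interp S) : FInterp S :=
  ⟨fun τ => I.sh τ.1, fun τ => I.st τ.1, I.Ih, I.It⟩

/-- The canonical extension of an `SQHT⁼_F` interpretation to all terms
(undefined outside terms without intensional sets); it is used to evaluate
`SQHT⁼_F` satisfaction, which only depends on the values on terms without
intensional sets. -/
def FInterp.toInterp {S : Sig.{v}} (J : FInterp S) : Interp S :=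
  ⟨fun τ => if h : IsZeroT τ then J.sh ⟨τ, h⟩ else none,
   fun τ => if h : IsZeroT τ then J.st ⟨τ, h⟩ else none, J.Ih, J.It⟩

/-- `SQHT⁼_F` satisfaction `I, w ⊨_F φ` (for `0`-formulas `φ`, i.e.
`SQHT⁼_F` formulas over `⟨C ∪ 𝒮, F, P⟩`): the same clauses as `⊨_𝒮`, with
quantifiers ranging over the Herbrand universe of `⟨C ∪ 𝒮, F, P⟩`. -/
def SatF {S : Sig.{v}} (J : FInterp S) (w : W) (φ : Formula S) : Prop :=
  SatS J.toInterp w φ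

/-- Validity of an `SQHT⁼_F` interpretation. -/
def FInterp.Valid {S : Sig.{v}} (J : FInterp S) : Prop := J.toInterp.Valid

/-! ## Orderings between interpretations, equilibrium and stable models -/

/-- `I₁ ≼ I₂` : same `there` component, smaller `here` component. -/
def ILe {S : Sig.{v}} (I1 I2 : Interp S) : Prop :=
  I1.It = I2.It ∧ I1.st = I2.st ∧ I1.Ih ⊆ I2.Ih ∧ AssignLe I1.sh I2.sh

/-- `I₁ ≺ I₂`. -/
def ILt {S : Sig.{v}} (I1 I2 : Interp S) : Prop := ILe I1 I2 ∧ I1 ≠ I2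

/-- The total interpretation `⟨σ, T⟩`. -/
def totalI {S : Sig.{v}} (σ : Assign S) (T : Set (GAtom S)) : Interp S := ⟨σ, σ, T, T⟩

/-- `I` is a model of the theory `Γ` : `I` is a (coherent) interpretation
and `I, h ⊨_𝒮 φ` for every `φ ∈ Γ`. -/
def ModelS {S : Sig.{v}} (I : Interp S) (Γ : Set (Formula S)) : Prop :=
  I.Valid ∧ I.Coherent ∧ ∀ φ ∈ Γ, SatS I .h φ

/-- `⟨σ, T⟩` is an equilibrium model of `Γ`. -/
def EqModelS {S : Sig.{v}} (Γ : Set (Formula S)) (σ : Assign S) (T : Set (GAtom S)) : Prop :=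
  ModelS (totalI σ T) Γ ∧ ∀ I', ILt I' (totalI σ T) → ¬ ModelS I' Γ

/-- `T` is a stable model of `Γ` (`SQHT⁼_𝒮` equilibrium semantics). -/
def StableS {S : Sig.{v}} (Γ : Set (Formula S)) (T : Set (GAtom S)) : Prop :=
  ∃ σ, EqModelS Γ σ T

/-- The ordering on `SQHT⁼_F` assignments. -/
def FAssignLe {S : Sig.{v}} (σ σ' : { τ : GTerm S // IsZeroT τ } → Option (D S)) : Prop :=
  ∀ τ, σ τ = σ' τ ∨ σ τ = none

/-- `≼` on `SQHT⁼_F` interpretations. -/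
def FILe {S : Sig.{v}} (J1 J2 : FInterp S) : Prop :=
  J1.It = J2.It ∧ J1.st = J2.st ∧ J1.Ih ⊆ J2.Ih ∧ FAssignLe J1.sh J2.sh

def FILt {S : Sig.{v}} (J1 J2 : FInterp S) : Prop := FILe J1 J2 ∧ J1 ≠ J2

def totalF {S : Sig.{v}} (σ : { τ : GTerm S // IsZeroT τ } → Option (D S))
    (T : Set (GAtom S)) : FInterp S := ⟨σ, σ, T, T⟩

/-- `J` is an `SQHT⁼_F` model of `Γ`. -/
def ModelF {S : Sig.{v}} (J : FInterp S) (Γ : Set (Formula S)) : Prop :=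
  J.Valid ∧ ∀ φ ∈ Γ, SatF J .h φ

/-- `T` is a stable model of `Γ` under the `SQHT⁼_F` equilibrium semantics
over the signature `⟨C ∪ 𝒮, F, P⟩`. -/
def StableF {S : Sig.{v}} (Γ : Set (Formula S)) (T : Set (GAtom S)) : Prop :=
  ∃ σ, ModelF (totalF σ T) Γ ∧ ∀ J', FILt J' (totalF σ T) → ¬ ModelF J' Γ
/-- `φ` is an `SQHT⁼_𝒮` tautology: every coherent interpretation satisfies it. -/
def TautS {S : Sig.{v}} (φ : Formula S) : Prop :=
  ∀ I : Interp S, I.Valid → I.Coherent → SatS I .h φ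

/-- `φ` is an `SQHT⁼_F` tautology (over `⟨C ∪ 𝒮, F, P⟩`): every `SQHT⁼_F`
interpretation satisfies it. -/
def TautF {S : Sig.{v}} (φ : Formula S) : Prop :=
  ∀ J : FInterp S, J.Valid → SatF J .h φ

/-! ## Extending an `SQHT⁼_F` interpretation to a coherent interpretation -/

theorem optFam_eq_none {α : Type u} {m : ℕ} {f : Fin m → Option α} (h : ∃ i, f i = none) :
    optFam f = none := by
  obtain ⟨i, hi⟩ := h
  refine dif_neg fun h => ?_
  have := h i
  simp [hi] at this

theorem optFam_eq_some {α : Type u} {m : ℕ} {f : Fin m → Option α} {g : Fin m → α}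
    (h : ∀ i, f i = some (g i)) : optFam f = some g := by
  obtain rfl : f = fun i => some (g i) := funext h
  simp [optFam]

theorem exists_eq_none_or_eq_some {ι : Type} {α : Type u} (f : ι → Option α) :
    (∃ i, f i = none) ∨ ∃ g : ι → α, ∀ i, f i = some (g i) := by
  by_cases h : ∃ i, f i = none
  · exact .inl h
  · push Not at h
    choose g hg using fun i => Option.ne_none_iff_exists'.1 (h i)
    exact .inr ⟨g, hg⟩

/-- The collection of the tuples of values `val c`, for those `c` with `sat c`, as a domain
element; undefined if one of these values is undefined. -/
def collect {S : Sig.{v}} {k n : ℕ} (sat : (Fin k → D S) → Prop)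
    (val : (Fin k → D S) → Fin (n + 1) → Option (D S)) : Option (D S) :=
  if ∃ c : Fin k → D S, sat c ∧ ∃ i, val c i = none then none
  else
    mkSet? { x | ∃ (c : Fin k → D S) (ds : Fin (n + 1) → D S),
      sat c ∧ (∀ i, val c i = some (ds i)) ∧ x = famToTup ds }

mutual
  /-- The value of a term in the coherent extension of `J`. -/
  def cohVal {S : Sig.{v}} (J : Interp S) : GTerm S → W → Option (D S)
    | .dom d, _ => some d
    | .ctor c args, w =>
        (optFam fun i => cohVal J (args i) w).bind fun ds =>
          J.s w (.ctor c fun i => .dom (ds i))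
    | .func f args, w =>
        (optFam fun i => cohVal J (args i) w).bind fun ds =>
          J.s w (.func f fun i => .dom (ds i))
    | .eset _ _ tups, w =>
        (optFam fun j => optFam fun i => cohVal J (tups j i) w).bind fun g =>
          mkSet? { x | ∃ j, x = famToTup (g j) }
    | .iset _ _ tv φ, w =>
        if collect (fun c => (cohSatLift J (φ c) w).down) (fun c i => cohVal J (tv c i) w) =
            collect (fun c => (cohSatLift J (φ c) .t).down) (fun c i => cohVal J (tv c i) .t) then
          collect (fun c => (cohSatLift J (φ c) w).down) (fun c i => cohVal J (tv c i) w)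
        else none

  /-- Satisfaction of a formula in the coherent extension of `J`, lifted to the universe of the
  domain. -/
  def cohSatLift {S : Sig.{v}} (J : Interp S) : Formula S → W → ULift.{1} Prop
    | .falsum, _ => ⟨False⟩
    | .verum, _ => ⟨True⟩
    | .atom p args, w => ⟨∃ ds : Fin (S.arP p) → D S,
        (∀ i, cohVal J (args i) w = some (ds i)) ∧ (⟨p, ds⟩ : GAtom S) ∈ J.atoms w⟩
    | .eq t1 t2, w => ⟨∃ d, cohVal J t1 w = some d ∧ cohVal J t2 w = some d⟩
    | .and a b, w => ⟨(cohSatLift J a w).down ∧ (cohSatLift J b w).down⟩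
    | .or a b, w => ⟨(cohSatLift J a w).down ∨ (cohSatLift J b w).down⟩
    | .imp a b, w =>
        ⟨∀ w', W.le w w' → ((cohSatLift J a w').down → (cohSatLift J b w').down)⟩
    | .all b, w => ⟨∀ d, (cohSatLift J (b d) w).down⟩
    | .ex b, w => ⟨∃ d, (cohSatLift J (b d) w).down⟩
end

/-- The coherent interpretation that keeps the values of `J` on function applications to domain
elements and the atoms of `J`, and evaluates sets by their extensions. -/
def Interp.cohExt {S : Sig.{v}} (J : Interp S) : Interp S :=
  ⟨fun τ => cohVal J τ .h, fun τ => cohVal J τ .t, J.Ih, J.It⟩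

theorem Interp.cohExt_s {S : Sig.{v}} (J : Interp S) (w : W) (τ : GTerm S) :
    J.cohExt.s w τ = cohVal J τ w := by
  cases w <;> rfl

theorem Interp.cohExt_atoms {S : Sig.{v}} (J : Interp S) (w : W) :
    J.cohExt.atoms w = J.atoms w := by
  cases w <;> rfl

theorem satS_cohExt_iff {S : Sig.{v}} (J : Interp S) :
    ∀ (φ : Formula S) (w : W), SatS J.cohExt w φ ↔ (cohSatLift J φ w).down
  | .falsum, _ => by simp only [SatS, cohSatLift]
  | .verum, _ => by simp only [SatS, cohSatLift]
  | .atom p args, w => by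
      simp only [SatS, cohSatLift, Interp.cohExt_s, Interp.cohExt_atoms]
  | .eq t1 t2, w => by simp only [SatS, cohSatLift, Interp.cohExt_s]
  | .and a b, w => by simp only [SatS, cohSatLift, satS_cohExt_iff J a, satS_cohExt_iff J b]
  | .or a b, w => by simp only [SatS, cohSatLift, satS_cohExt_iff J a, satS_cohExt_iff J b]
  | .imp a b, w => by simp only [SatS, cohSatLift, satS_cohExt_iff J a, satS_cohExt_iff J b]
  | .all b, w => by simp only [SatS, cohSatLift, fun d => satS_cohExt_iff J (b d)]
  | .ex b, w => by simp only [SatS, cohSatLift, fun d => satS_cohExt_iff J (b d)]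

theorem extw_cohExt {S : Sig.{v}} (J : Interp S) (w : W) (k n : ℕ)
    (tv : (Fin k → D S) → Fin (n + 1) → GTerm S) (φ : (Fin k → D S) → Formula S) :
    extw J.cohExt w k n tv φ =
      collect (fun c => (cohSatLift J (φ c) w).down) (fun c i => cohVal J (tv c i) w) := by
  simp only [extw, collect, satS_cohExt_iff, Interp.cohExt_s]

theorem cohVal_ctor_dom {S : Sig.{v}} (J : Interp S) (w : W) (c : S.C)
    (ds : Fin (S.arC c) → D S) :
    cohVal J (.ctor c fun i => .dom (ds i)) w = J.s w (.ctor c fun i => .dom (ds i)) := by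
  rw [cohVal, optFam_eq_some (g := ds) fun i => by rw [cohVal]]
  rfl

theorem cohVal_func_dom {S : Sig.{v}} (J : Interp S) (w : W) (f : S.F)
    (ds : Fin (S.arF f) → D S) :
    cohVal J (.func f fun i => .dom (ds i)) w = J.s w (.func f fun i => .dom (ds i)) := by
  rw [cohVal, optFam_eq_some (g := ds) fun i => by rw [cohVal]]
  rfl

theorem cval_cohExt {S : Sig.{v}} (J : Interp S) (w : W) :
    ∀ τ : GTerm S, cval J.cohExt w τ = cohVal J τ w
  | .dom d => by rw [cval, cohVal]
  | .ctor c args => by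
      rw [cval, cohVal]
      simp only [fun i => cval_cohExt J w (args i), Interp.cohExt_s, cohVal_ctor_dom]
      cases optFam fun i => cohVal J (args i) w <;> rfl
  | .func f args => by
      rw [cval, cohVal]
      simp only [fun i => cval_cohExt J w (args i), Interp.cohExt_s, cohVal_func_dom]
      cases optFam fun i => cohVal J (args i) w <;> rfl
  | .eset m n tups => by
      rw [cval, cohVal]
      simp only [fun j i => cval_cohExt J w (tups j i)]
      cases optFam fun j => optFam fun i => cohVal J (tups j i) w <;> rfl
  | .iset k n tv φ => by
      cases w <;> simp only [cval, cohVal, extw_cohExt, if_true]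

theorem Interp.cohExt_coherent {S : Sig.{v}} (J : Interp S) : J.cohExt.Coherent := by
  rw [Interp.Coherent, CohC, funext (cval_cohExt J .h), funext (cval_cohExt J .t)]
  rfl

theorem cohVal_eset_of_none {S : Sig.{v}} (J : Interp S) (w : W) {m n : ℕ}
    {tups : Fin m → Fin (n + 1) → GTerm S} (h : ∃ j i, cohVal J (tups j i) w = none) :
    cohVal J (.eset m n tups) w = none := by
  obtain ⟨j, hj⟩ := h
  rw [cohVal, optFam_eq_none ⟨j, optFam_eq_none hj⟩]
  rfl

theorem cohVal_eset_of_some {S : Sig.{v}} (J : Interp S) (w : W) {m n : ℕ}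
    {tups : Fin m → Fin (n + 1) → GTerm S} {ds : Fin m → Fin (n + 1) → D S}
    (h : ∀ j i, cohVal J (tups j i) w = some (ds j i)) :
    cohVal J (.eset m n tups) w = mkSet? { x | ∃ j, x = famToTup (ds j) } := by
  rw [cohVal, optFam_eq_some fun j => optFam_eq_some (h j)]
  rfl

theorem cohVal_ctor_of_none {S : Sig.{v}} (J : Interp S) (w : W) {c : S.C}
    {args : Fin (S.arC c) → GTerm S} (h : ∃ i, cohVal J (args i) w = none) :
    cohVal J (.ctor c args) w = none := by
  rw [cohVal, optFam_eq_none h]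
  rfl

theorem cohVal_ctor_of_some {S : Sig.{v}} (J : Interp S) (w : W) {c : S.C}
    {args : Fin (S.arC c) → GTerm S} {ds : Fin (S.arC c) → D S}
    (h : ∀ i, cohVal J (args i) w = some (ds i)) :
    cohVal J (.ctor c args) w = J.s w (.ctor c fun i => .dom (ds i)) := by
  rw [cohVal, optFam_eq_some h]
  rfl

theorem cohVal_func_of_none {S : Sig.{v}} (J : Interp S) (w : W) {f : S.F}
    {args : Fin (S.arF f) → GTerm S} (h : ∃ i, cohVal J (args i) w = none) :
    cohVal J (.func f args) w = none := by
  rw [cohVal, optFam_eq_none h]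
  rfl

theorem cohVal_func_of_some {S : Sig.{v}} (J : Interp S) (w : W) {f : S.F}
    {args : Fin (S.arF f) → GTerm S} {ds : Fin (S.arF f) → D S}
    (h : ∀ i, cohVal J (args i) w = some (ds i)) :
    cohVal J (.func f args) w = J.s w (.func f fun i => .dom (ds i)) := by
  rw [cohVal, optFam_eq_some h]
  rfl

theorem assignValid_cohVal {S : Sig.{v}} {J : Interp S} {w : W} (hJ : AssignValid (J.s w)) :
    AssignValid fun τ => cohVal J τ w := by
  obtain ⟨-, -, -, hH, -⟩ := hJ
  refine ⟨fun d => by simp only [cohVal], fun c args h => cohVal_ctor_of_none J w h,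
    fun c args ds h => ?_, fun c hs => ?_, fun f args h => cohVal_func_of_none J w h,
    fun f args ds h => ?_, fun m n tups h => cohVal_eset_of_none J w h,
    fun m n tups ds h => cohVal_eset_of_some J w h⟩
  · exact (cohVal_ctor_of_some J w h).trans (cohVal_ctor_dom J w c ds).symm
  · exact (cohVal_ctor_dom J w c fun i => atomD (hs i)).trans (hH c hs)
  · exact (cohVal_func_of_some J w h).trans (cohVal_func_dom J w f ds).symm

theorem cohVal_here_eq_there_or_none {S : Sig.{v}} {J : Interp S} (hJ : AssignLe J.sh J.st) :
    ∀ τ : GTerm S, cohVal J τ .h = cohVal J τ .t ∨ cohVal J τ .h = none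
  | .dom d => by simp only [cohVal, true_or]
  | .ctor c args => by
      rcases exists_eq_none_or_eq_some fun i => cohVal J (args i) .h with h | ⟨ds, h⟩
      · exact .inr (cohVal_ctor_of_none J .h h)
      · have ht i : cohVal J (args i) .t = some (ds i) := by
          simpa [h i, eq_comm] using cohVal_here_eq_there_or_none hJ (args i)
        rw [cohVal_ctor_of_some J .h h, cohVal_ctor_of_some J .t ht]
        exact hJ _
  | .func f args => by
      rcases exists_eq_none_or_eq_some fun i => cohVal J (args i) .h with h | ⟨ds, h⟩
      · exact .inr (cohVal_func_of_none J .h h)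
      · have ht i : cohVal J (args i) .t = some (ds i) := by
          simpa [h i, eq_comm] using cohVal_here_eq_there_or_none hJ (args i)
        rw [cohVal_func_of_some J .h h, cohVal_func_of_some J .t ht]
        exact hJ _
  | .eset m n tups => by
      rcases exists_eq_none_or_eq_some fun p : Fin m × Fin (n + 1) =>
        cohVal J (tups p.1 p.2) .h with ⟨p, h⟩ | ⟨ds, h⟩
      · exact .inr (cohVal_eset_of_none J .h ⟨p.1, p.2, h⟩)
      · have ht j i : cohVal J (tups j i) .t = some (ds (j, i)) := by
          simpa [h (j, i), eq_comm] using cohVal_here_eq_there_or_none hJ (tups j i)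
        left
        rw [cohVal_eset_of_some J .h fun j i => h (j, i), cohVal_eset_of_some J .t ht]
  | .iset k n tv φ => by
      simp only [cohVal, if_true]
      split_ifs with h
      · exact .inl h
      · exact .inr rfl

theorem Interp.Valid.cohExt {S : Sig.{v}} {J : Interp S} (hJ : J.Valid) : J.cohExt.Valid :=
  ⟨assignValid_cohVal (w := .h) hJ.1, assignValid_cohVal (w := .t) hJ.2.1,
    cohVal_here_eq_there_or_none hJ.2.2.1, hJ.2.2.2⟩

/-- The coherent extension agrees with `J` on terms without intensional sets. -/
theorem cohVal_of_isZeroT {S : Sig.{v}} {J : Interp S} {w : W} (hJ : AssignValid (J.s w)) :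
    ∀ τ : GTerm S, IsZeroT τ → cohVal J τ w = J.s w τ
  | .dom d, _ => by rw [cohVal, hJ.1]
  | .ctor c args, h0 => by
      rw [IsZeroT] at h0
      have ih i := cohVal_of_isZeroT hJ (args i) (h0 i)
      obtain ⟨-, hn, hs, -⟩ := hJ
      rcases exists_eq_none_or_eq_some fun i => J.s w (args i) with h | ⟨ds, h⟩
      · rw [hn c args h, cohVal_ctor_of_none J w (by simpa only [ih] using h)]
      · rw [hs c args ds h, cohVal_ctor_of_some J w fun i => (ih i).trans (h i)]
  | .func f args, h0 => by
      rw [IsZeroT] at h0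
      have ih i := cohVal_of_isZeroT hJ (args i) (h0 i)
      obtain ⟨-, -, -, -, hn, hs, -⟩ := hJ
      rcases exists_eq_none_or_eq_some fun i => J.s w (args i) with h | ⟨ds, h⟩
      · rw [hn f args h, cohVal_func_of_none J w (by simpa only [ih] using h)]
      · rw [hs f args ds h, cohVal_func_of_some J w fun i => (ih i).trans (h i)]
  | .eset m n tups, h0 => by
      rw [IsZeroT] at h0
      have ih j i := cohVal_of_isZeroT hJ (tups j i) (h0 j i)
      obtain ⟨-, -, -, -, -, -, hn, hs⟩ := hJ
      rcases exists_eq_none_or_eq_some fun p : Fin m × Fin (n + 1) =>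
        J.s w (tups p.1 p.2) with ⟨p, h⟩ | ⟨ds, h⟩
      · rw [hn m n tups ⟨p.1, p.2, h⟩, cohVal_eset_of_none J w ⟨p.1, p.2, (ih _ _).trans h⟩]
      · rw [hs m n tups (fun j i => ds (j, i)) fun j i => h (j, i),
          cohVal_eset_of_some J w fun j i => (ih j i).trans (h (j, i))]
  | .iset k n tv φ, h0 => by
      rw [IsZeroT] at h0
      exact h0.elim

/-! ## Satisfaction of `0`-formulas -/

/-- Satisfaction of a `0`-formula depends only on the atoms and on the values of terms without
intensional sets. -/
theorem satS_congr_of_isZeroF {S : Sig.{v}} {I J : Interp S}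
    (hs : ∀ w τ, IsZeroT τ → I.s w τ = J.s w τ) (ha : ∀ w, I.atoms w = J.atoms w) :
    ∀ (φ : Formula S), IsZeroF φ → ∀ w, SatS I w φ ↔ SatS J w φ
  | .falsum, _, _ => by simp only [SatS]
  | .verum, _, _ => by simp only [SatS]
  | .atom p args, h0, w => by
      rw [IsZeroF] at h0
      simp only [SatS, fun i => hs w (args i) (h0 i), ha]
  | .eq t1 t2, h0, w => by
      rw [IsZeroF] at h0
      simp only [SatS, hs w t1 h0.1, hs w t2 h0.2]
  | .and a b, h0, w => by
      rw [IsZeroF] at h0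
      simp only [SatS, satS_congr_of_isZeroF hs ha a h0.1, satS_congr_of_isZeroF hs ha b h0.2]
  | .or a b, h0, w => by
      rw [IsZeroF] at h0
      simp only [SatS, satS_congr_of_isZeroF hs ha a h0.1, satS_congr_of_isZeroF hs ha b h0.2]
  | .imp a b, h0, w => by
      rw [IsZeroF] at h0
      simp only [SatS, satS_congr_of_isZeroF hs ha a h0.1, satS_congr_of_isZeroF hs ha b h0.2]
  | .all b, h0, w => by
      rw [IsZeroF] at h0
      simp only [SatS, fun d => satS_congr_of_isZeroF hs ha (b d) (h0 d)]
  | .ex b, h0, w => by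
      rw [IsZeroF] at h0
      simp only [SatS, fun d => satS_congr_of_isZeroF hs ha (b d) (h0 d)]

/-! ## Restricting an interpretation to terms without intensional sets -/

theorem isZeroT_of_restrict_eq_some {S : Sig.{v}} {σ : Assign S} {τ : GTerm S} {d : D S}
    (h : (if IsZeroT τ then σ τ else none) = some d) : IsZeroT τ := by
  by_contra h0
  simp [h0] at h

theorem AssignValid.restrict {S : Sig.{v}} {σ : Assign S} (hσ : AssignValid σ) :
    AssignValid fun τ => if IsZeroT τ then σ τ else none := by
  obtain ⟨h1, h2, h3, h4, h5, h6, h7, h8⟩ := hσ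
  refine ⟨fun d => ?_, fun c args h => ?_, fun c args ds h => ?_, fun c hs => ?_,
    fun f args h => ?_, fun f args ds h => ?_, fun m n tups h => ?_, fun m n tups ds h => ?_⟩
  · simp only [IsZeroT, if_true, h1]
  · obtain ⟨i, hi⟩ := h
    by_cases h0 : IsZeroT (GTerm.ctor c args)
    · refine (if_pos h0).trans (h2 c args ⟨i, ?_⟩)
      rw [IsZeroT] at h0
      exact (if_pos (h0 i)).symm.trans hi
    · exact if_neg h0
  · have h0 i := isZeroT_of_restrict_eq_some (h i)
    simp only [h0, if_true] at h
    simpa only [IsZeroT, h0, implies_true, if_true] using h3 c args ds h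
  · simpa only [IsZeroT, implies_true, if_true] using h4 c hs
  · obtain ⟨i, hi⟩ := h
    by_cases h0 : IsZeroT (GTerm.func f args)
    · refine (if_pos h0).trans (h5 f args ⟨i, ?_⟩)
      rw [IsZeroT] at h0
      exact (if_pos (h0 i)).symm.trans hi
    · exact if_neg h0
  · have h0 i := isZeroT_of_restrict_eq_some (h i)
    simp only [h0, if_true] at h
    simpa only [IsZeroT, h0, implies_true, if_true] using h6 f args ds h
  · obtain ⟨j, i, hi⟩ := h
    by_cases h0 : IsZeroT (GTerm.eset m n tups)
    · refine (if_pos h0).trans (h7 m n tups ⟨j, i, ?_⟩)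
      rw [IsZeroT] at h0
      exact (if_pos (h0 j i)).symm.trans hi
    · exact if_neg h0
  · have h0 j i := isZeroT_of_restrict_eq_some (h j i)
    simp only [h0, if_true] at h
    simpa only [IsZeroT, h0, implies_true, if_true] using h8 m n tups ds h

theorem Interp.Valid.hat {S : Sig.{v}} {I : Interp S} (hI : I.Valid) : I.hat.Valid := by
  refine ⟨hI.1.restrict, hI.2.1.restrict, fun τ => ?_, hI.2.2.2⟩
  by_cases h0 : IsZeroT τ
  · simpa only [FInterp.toInterp, Interp.hat, h0, dite_true] using hI.2.2.1 τ
  · exact .inr (dif_neg h0)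

theorem satF_hat_iff {S : Sig.{v}} (I : Interp S) {φ : Formula S} (h0 : IsZeroF φ) (w : W) :
    SatF I.hat w φ ↔ SatS I w φ := by
  refine satS_congr_of_isZeroF (fun w τ hτ => ?_) (fun w => ?_) φ h0 w
  · cases w <;> exact dif_pos hτ
  · cases w <;> rfl

/-- For any `0`-formula `φ`: `φ` is an `SQHT⁼_𝒮` tautology
iff `φ` is an `SQHT⁼_F` tautology (over the signature `⟨C ∪ 𝒮, F, P⟩`). -/
theorem tautS_iff_tautF {S : Sig.{v}} (φ : Formula S) (h0 : IsZeroF φ) :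
    TautS φ ↔ TautF φ := by
  constructor
  · intro h J hJ
    have hs : ∀ w, AssignValid (J.toInterp.s w) := by
      rintro (_ | _)
      exacts [hJ.1, hJ.2.1]
    refine (satS_congr_of_isZeroF (fun w τ hτ => ?_) J.toInterp.cohExt_atoms φ h0 .h).1
      (h _ (Interp.Valid.cohExt hJ) J.toInterp.cohExt_coherent)
    rw [Interp.cohExt_s, cohVal_of_isZeroT (hs w) τ hτ]
  · intro h I hI _
    exact (satF_hat_iff I h0 .h).1 (h _ hI.hat)

end
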